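/- arXiv:physics/0508173 — 2 statements merged into one kernel-verified Lean document; each statement's English description precedes it below -/
import Mathlib

section
/- Let α be a real number and let p, q : ℝ³ → ℝ³ be smooth vector fields. Then at every point of ℝ³ the commutator of the advection operator with the Helmholtz operator satisfies (p·∇)((1−α²Δ)q) − (1−α²Δ)((p·∇)q) = α² div(∇q·∇p + ∇q·(∇p)ᵀ) − α² ((∇(div p))·∇)q. -/
open Matrix MeasureTheory

noncomputable section

abbrev V3 := Fin 3 → ℝ

/-- Partial derivative `∂_j f` of a scalar field on ℝ³. -/
def pd (j : Fin 3) (f : V3 → ℝ) (x : V3) : ℝ := fderiv ℝ f x (Pi.single j 1)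

/-- Jacobian matrix field: `(∇f)_{ij} = ∂f_i/∂x_j`. -/
def grad (f : V3 → V3) (x : V3) : Matrix (Fin 3) (Fin 3) ℝ :=
  Matrix.of fun i j => pd j (fun y => f y i) x

/-- Divergence of a vector field. -/
def divV (f : V3 → V3) (x : V3) : ℝ := ∑ j, pd j (fun y => f y j) x

/-- Divergence of a matrix field: `(div M)_i = Σ_j ∂_j M_{ij}`. -/
def divM (M : V3 → Matrix (Fin 3) (Fin 3) ℝ) (x : V3) (i : Fin 3) : ℝ :=
  ∑ j, pd j (fun y => M y i j) x

/-- Scalar Laplacian. -/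
def lapS (φ : V3 → ℝ) (x : V3) : ℝ := ∑ j, pd j (fun y => pd j φ y) x

/-- Componentwise Laplacian of a vector field. -/
def lap (f : V3 → V3) (x : V3) (i : Fin 3) : ℝ := lapS (fun y => f y i) x

/-- Helmholtz operator `(1 - α²Δ)` on vector fields. -/
def helm (α : ℝ) (f : V3 → V3) (x : V3) (i : Fin 3) : ℝ := f x i - α ^ 2 * lap f x i

/-- Helmholtz operator `(1 - α²Δ)` on scalar fields. -/
def helmS (α : ℝ) (φ : V3 → ℝ) (x : V3) : ℝ := φ x - α ^ 2 * lapS φ x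

/-- Advection `(g·∇)f = Σ_j g_j ∂_j f`. -/
def advect (g f : V3 → V3) (x : V3) (i : Fin 3) : ℝ :=
  ∑ j, g x j * pd j (fun y => f y i) x

/-- `(∇f)ᵀ·g`, pointwise matrix-vector product. -/
def gradTvec (f g : V3 → V3) (x : V3) (i : Fin 3) : ℝ :=
  ∑ j, (grad f x)ᵀ i j * g x j

/-- Gradient of a scalar field. -/
def gradS (φ : V3 → ℝ) (x : V3) (i : Fin 3) : ℝ := pd i φ x

/-- Pointwise squared Euclidean norm `|f|²`. -/
def normSq (f : V3 → V3) (x : V3) : ℝ := ∑ i, (f x i) ^ 2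

/-- Squared Frobenius norm of the Jacobian, `|∇f|²`. -/
def gradNormSq (f : V3 → V3) (x : V3) : ℝ := ∑ i, ∑ j, (grad f x i j) ^ 2

theorem ContDiff.pd {f : V3 → ℝ} (hf : ContDiff ℝ (⊤ : ℕ∞) f) (j : Fin 3) :
    ContDiff ℝ (⊤ : ℕ∞) (fun y => pd j f y) :=
  (hf.fderiv_right (m := ((⊤ : ℕ∞) : WithTop ℕ∞)) (by simp)).clm_apply contDiff_const

theorem ContDiff.differentiableAt_top {f : V3 → ℝ} (hf : ContDiff ℝ (⊤ : ℕ∞) f) (x : V3) :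
    DifferentiableAt ℝ f x :=
  (hf.differentiable (by simp)).differentiableAt

theorem pd_add {f g : V3 → ℝ} (hf : ContDiff ℝ (⊤ : ℕ∞) f) (hg : ContDiff ℝ (⊤ : ℕ∞) g)
    (j : Fin 3) (x : V3) : pd j (fun y => f y + g y) x = pd j f x + pd j g x := by
  simp only [pd]
  rw [fderiv_fun_add (hf.differentiableAt_top x) (hg.differentiableAt_top x)]
  rfl

theorem pd_sub {f g : V3 → ℝ} (hf : ContDiff ℝ (⊤ : ℕ∞) f) (hg : ContDiff ℝ (⊤ : ℕ∞) g)
    (j : Fin 3) (x : V3) : pd j (fun y => f y - g y) x = pd j f x - pd j g x := by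
  simp only [pd]
  rw [fderiv_fun_sub (hf.differentiableAt_top x) (hg.differentiableAt_top x)]
  rfl

theorem pd_mul {f g : V3 → ℝ} (hf : ContDiff ℝ (⊤ : ℕ∞) f) (hg : ContDiff ℝ (⊤ : ℕ∞) g)
    (j : Fin 3) (x : V3) :
    pd j (fun y => f y * g y) x = f x * pd j g x + g x * pd j f x := by
  simp only [pd]
  rw [fderiv_fun_mul (hf.differentiableAt_top x) (hg.differentiableAt_top x)]
  rfl

theorem pd_const_mul {f : V3 → ℝ} (hf : ContDiff ℝ (⊤ : ℕ∞) f) (c : ℝ)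
    (j : Fin 3) (x : V3) : pd j (fun y => c * f y) x = c * pd j f x := by
  simp only [pd]
  rw [fderiv_const_mul (hf.differentiableAt_top x)]
  rfl

theorem pd_sum {f : Fin 3 → V3 → ℝ} (hf : ∀ k, ContDiff ℝ (⊤ : ℕ∞) (f k))
    (j : Fin 3) (x : V3) : pd j (fun y => ∑ k, f k y) x = ∑ k, pd j (f k) x := by
  simp only [pd]
  rw [fderiv_fun_sum fun k _ => (hf k).differentiableAt_top x]
  simp

/-- Partial derivatives of a smooth scalar field commute. -/
theorem pd_comm {f : V3 → ℝ} (hf : ContDiff ℝ (⊤ : ℕ∞) f) (j k : Fin 3) (x : V3) :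
    pd j (fun y => pd k f y) x = pd k (fun y => pd j f y) x := by
  have hd : DifferentiableAt ℝ (fderiv ℝ f) x :=
    ((hf.fderiv_right (m := ((⊤ : ℕ∞) : WithTop ℕ∞)) (by simp)).differentiable
      (by simp)).differentiableAt
  have hsymm : IsSymmSndFDerivAt ℝ f x :=
    hf.contDiffAt.isSymmSndFDerivAt
      (by simpa using WithTop.coe_le_coe.2 (le_top (a := (2 : ℕ∞))))
  have key : ∀ a b : Fin 3, pd a (fun y => pd b f y) x
      = fderiv ℝ (fderiv ℝ f) x (Pi.single a 1) (Pi.single b 1) := by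
    intro a b
    simp only [pd]
    rw [fderiv_clm_apply hd (differentiableAt_const _)]
    simp
  rw [key, key]
  exact hsymm _ _

/-- Commuting a partial derivative past the Laplacian. -/
theorem pd_lapS {f : V3 → ℝ} (hf : ContDiff ℝ (⊤ : ℕ∞) f) (j : Fin 3) (x : V3) :
    pd j (lapS f) x = lapS (fun y => pd j f y) x := by
  unfold lapS
  rw [pd_sum fun k => (hf.pd k).pd k]
  refine Finset.sum_congr rfl fun k _ => ?_
  rw [pd_comm (hf.pd k) j k]
  congr 1
  funext y
  exact pd_comm hf j k y

theorem ContDiff.lapS {f : V3 → ℝ} (hf : ContDiff ℝ (⊤ : ℕ∞) f) :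
    ContDiff ℝ (⊤ : ℕ∞) (lapS f) :=
  ContDiff.sum fun k _ => (hf.pd k).pd k

theorem lapS_mul {f g : V3 → ℝ} (hf : ContDiff ℝ (⊤ : ℕ∞) f) (hg : ContDiff ℝ (⊤ : ℕ∞) g)
    (x : V3) :
    lapS (fun y => f y * g y) x
      = f x * lapS g x + g x * lapS f x + 2 * ∑ k, pd k f x * pd k g x := by
  unfold lapS
  simp only [pd_mul hf hg, Finset.mul_sum, ← Finset.sum_add_distrib]
  refine Finset.sum_congr rfl fun k _ => ?_
  rw [pd_add (hf.mul (hg.pd k)) (hg.mul (hf.pd k)), pd_mul hf (hg.pd k), pd_mul hg (hf.pd k)]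
  ring

theorem lapS_sum {f : Fin 3 → V3 → ℝ} (hf : ∀ k, ContDiff ℝ (⊤ : ℕ∞) (f k)) (x : V3) :
    lapS (fun y => ∑ k, f k y) x = ∑ k, lapS (f k) x := by
  unfold lapS
  simp only [pd_sum hf]
  rw [Finset.sum_comm]
  exact Finset.sum_congr rfl fun j _ => pd_sum (fun k => (hf k).pd j) j x

/-- commutator of advection with the Helmholtz operator. -/
theorem advection_helmholtz_commutator (α : ℝ) (p q : V3 → V3)
    (hp : ContDiff ℝ (⊤ : ℕ∞) p) (hq : ContDiff ℝ (⊤ : ℕ∞) q) :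
    ∀ x : V3, ∀ i : Fin 3,
      advect p (helm α q) x i - helm α (advect p q) x i
        = α ^ 2 * divM (fun y => grad q y * grad p y + grad q y * (grad p y)ᵀ) x i
          - α ^ 2 * advect (gradS (divV p)) q x i := by
  intro x i
  have hP : ∀ j, ContDiff ℝ (⊤ : ℕ∞) fun y => p y j := contDiff_pi.1 hp
  have hQ : ContDiff ℝ (⊤ : ℕ∞) fun y => q y i := contDiff_pi.1 hq i
  have hhelm : ∀ j, pd j (fun y => helm α q y i) x
      = pd j (fun y => q y i) x - α ^ 2 * lapS (fun y => pd j (fun z => q z i) y) x := by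
    intro j
    rw [← pd_lapS hQ, ← pd_const_mul hQ.lapS, ← pd_sub hQ (contDiff_const.mul hQ.lapS)]
    rfl
  have hlap : lap (advect p q) x i
      = ∑ j, (p x j * lapS (fun y => pd j (fun z => q z i) y) x
        + pd j (fun z => q z i) x * lapS (fun y => p y j) x
        + 2 * ∑ k, pd k (fun y => p y j) x * pd k (fun y => pd j (fun z => q z i) y) x) := by
    unfold lap advect
    rw [lapS_sum fun j => (hP j).mul (hQ.pd j)]
    exact Finset.sum_congr rfl fun j _ => lapS_mul (hP j) (hQ.pd j) x
  have hdiv : divM (fun y => grad q y * grad p y + grad q y * (grad p y)ᵀ) x i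
      = ∑ j, ∑ k, (pd k (fun z => q z i) x * pd j (fun y => pd j (fun z => p z k) y) x
        + pd j (fun z => p z k) x * pd j (fun y => pd k (fun z => q z i) y) x
        + (pd k (fun z => q z i) x * pd j (fun y => pd k (fun z => p z j) y) x
        + pd k (fun z => p z j) x * pd j (fun y => pd k (fun z => q z i) y) x)) := by
    unfold divM
    refine Finset.sum_congr rfl fun j _ => ?_
    simp only [Matrix.add_apply, Matrix.mul_apply, Matrix.transpose_apply, grad, Matrix.of_apply,
      ← Finset.sum_add_distrib]
    have h₁ : ∀ k, ContDiff ℝ (⊤ : ℕ∞)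
        fun y => pd k (fun z => q z i) y * pd j (fun z => p z k) y :=
      fun k => (hQ.pd k).mul ((hP k).pd j)
    have h₂ : ∀ k, ContDiff ℝ (⊤ : ℕ∞)
        fun y => pd k (fun z => q z i) y * pd k (fun z => p z j) y :=
      fun k => (hQ.pd k).mul ((hP j).pd k)
    rw [pd_sum fun k => (h₁ k).add (h₂ k)]
    refine Finset.sum_congr rfl fun k _ => ?_
    rw [pd_add (h₁ k) (h₂ k), pd_mul (hQ.pd k) ((hP k).pd j), pd_mul (hQ.pd k) ((hP j).pd k)]
  have hgrad : ∀ k, gradS (divV p) x k = ∑ j, pd j (fun y => pd k (fun z => p z j) y) x := by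
    intro k
    unfold gradS divV
    rw [pd_sum fun j => (hP j).pd j]
    exact Finset.sum_congr rfl fun j _ => pd_comm (hP j) k j x
  have hcomm : ∀ j k, pd j (fun y => pd k (fun z => q z i) y) x
      = pd k (fun y => pd j (fun z => q z i) y) x := fun j k => pd_comm hQ j k x
  rw [hdiv, helm, hlap]
  simp only [advect, hhelm, hgrad, lapS, Fin.sum_univ_three, hcomm 1 0, hcomm 2 0, hcomm 2 1]
  ring
end
end

section
/- (Unsmoothed form of the ideal LAMHD-α induction equation.) Let α be a real number and let u_s, B_s : ℝ × ℝ³ → ℝ³ be smooth time-dependent vector fields with div u_s(t,·) = 0 and div B_s(t,·) = 0 for all t, satisfying the ideal induction equation ∂_t B_s + (u_s·∇)B_s − (B_s·∇)u_s = 0 pointwise. Set u = (1−α²Δ)u_s and B = (1−α²Δ)B_s (Laplacian in the space variables). Then at every point, ∂_t B + (u_s·∇)B − (B_s·∇)u = α² div( ∇B_s·∇u_s + ∇B_s·(∇u_s)ᵀ − ∇u_s·∇B_s − ∇u_s·(∇B_s)ᵀ ). -/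
open Matrix MeasureTheory

noncomputable section

/-- Spatial tslice at time `t` of a time-dependent vector field. -/
def tslice (f : ℝ × V3 → V3) (t : ℝ) : V3 → V3 := fun x => f (t, x)

/-- The algebra of smooth real-valued functions on a normed space. -/
def smoothFunctions (E : Type*) [NormedAddCommGroup E] [NormedSpace ℝ E] :
    Subalgebra ℝ (E → ℝ) where
  carrier := {f | ContDiff ℝ (⊤ : ℕ∞) f}
  mul_mem' {f g} hf hg := show ContDiff ℝ (⊤ : ℕ∞) (fun x => f x * g x) from
    ContDiff.mul (show ContDiff ℝ _ f from hf) (show ContDiff ℝ _ g from hg)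
  add_mem' {f g} hf hg := show ContDiff ℝ (⊤ : ℕ∞) (fun x => f x + g x) from
    ContDiff.add (show ContDiff ℝ _ f from hf) (show ContDiff ℝ _ g from hg)
  algebraMap_mem' c := show ContDiff ℝ (⊤ : ℕ∞) (fun _ : E => c) from contDiff_const

section DirectionalDerivative

variable {E : Type*} [NormedAddCommGroup E] [NormedSpace ℝ E]

theorem smoothFunctions_contDiff (f : smoothFunctions E) :
    ContDiff ℝ (⊤ : ℕ∞) (f : E → ℝ) := f.2

theorem smoothFunctions_differentiable (f : smoothFunctions E) :
    Differentiable ℝ (f : E → ℝ) :=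
  (smoothFunctions_contDiff f).differentiable (by simp)

/-- The directional derivative along a constant vector, as a derivation of the algebra of smooth
functions. -/
def dirDeriv (v : E) : Derivation ℝ (smoothFunctions E) (smoothFunctions E) :=
  Derivation.mk'
    { toFun := fun f => ⟨fun p => fderiv ℝ (f : E → ℝ) p v,
        ((smoothFunctions_contDiff f).fderiv_right (m := (⊤ : ℕ∞)) (by simp)).clm_apply
          contDiff_const⟩
      map_add' := fun f g => by
        ext p
        have h := fderiv_add (smoothFunctions_differentiable f p)
          (smoothFunctions_differentiable g p)
        exact congrArg (fun L : E →L[ℝ] ℝ => L v) h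
      map_smul' := fun c f => by
        ext p
        have h := fderiv_const_smul (smoothFunctions_differentiable f p) c
        exact congrArg (fun L : E →L[ℝ] ℝ => L v) h }
    (fun f g => by
      ext p
      have h := fderiv_mul (smoothFunctions_differentiable f p)
        (smoothFunctions_differentiable g p)
      exact congrArg (fun L : E →L[ℝ] ℝ => L v) h)

theorem dirDeriv_apply (v : E) (f : smoothFunctions E) (p : E) :
    (dirDeriv v f : E → ℝ) p = fderiv ℝ (f : E → ℝ) p v := rfl

theorem dirDeriv_comm (v w : E) (f : smoothFunctions E) :
    dirDeriv v (dirDeriv w f) = dirDeriv w (dirDeriv v f) := by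
  have hf : ContDiff ℝ (⊤ : ℕ∞) (f : E → ℝ) := smoothFunctions_contDiff f
  have hd : Differentiable ℝ (fderiv ℝ (f : E → ℝ)) :=
    (hf.fderiv_right (m := (⊤ : ℕ∞)) (by simp)).differentiable (by simp)
  have h : ∀ (a b p : E), (dirDeriv a (dirDeriv b f) : E → ℝ) p
      = fderiv ℝ (fderiv ℝ (f : E → ℝ)) p a b := by
    intro a b p
    change fderiv ℝ (fun q => fderiv ℝ (f : E → ℝ) q b) p a = _
    rw [fderiv_clm_apply (hd p) (differentiableAt_const b)]
    simp
  ext p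
  rw [h, h]
  exact (hf.contDiffAt.isSymmSndFDerivAt (by simp; exact WithTop.coe_le_coe.2 le_top)) v w

end DirectionalDerivative

/-- The Laplacian of the ideal induction equation, for commuting derivations of a commutative
algebra. -/
theorem laplacian_induction_eq {A : Type*} [CommRing A] [Algebra ℝ A]
    (T : Derivation ℝ A A) (d : Fin 3 → Derivation ℝ A A)
    (hT : ∀ j f, T (d j f) = d j (T f)) (hd : ∀ j k f, d j (d k f) = d k (d j f))
    (u b : Fin 3 → A) (hu : ∑ j, d j (u j) = 0) (hb : ∑ j, d j (b j) = 0)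
    (hind : ∀ i, T (b i) + ∑ j, u j * d j (b i) - ∑ j, b j * d j (u i) = 0) (i : Fin 3) :
    T (∑ k, d k (d k (b i))) + ∑ j, u j * d j (∑ k, d k (d k (b i)))
        - ∑ j, b j * d j (∑ k, d k (d k (u i)))
      = -∑ j, d j (∑ k, d k (b i) * d j (u k) + ∑ k, d k (b i) * d k (u j)
          - ∑ k, d k (u i) * d j (b k) - ∑ k, d k (u i) * d k (b j)) := by
  have hTb : T (b i) = ∑ j, b j * d j (u i) - ∑ j, u j * d j (b i) := by
    linear_combination hind i
  have hu' : ∀ k, d k (∑ j, d j (u j)) = 0 := fun k => by rw [hu, map_zero]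
  have hb' : ∀ k, d k (∑ j, d j (b j)) = 0 := fun k => by rw [hb, map_zero]
  have hu0 := hu' 0
  have hu1 := hu' 1
  have hu2 := hu' 2
  have hb0 := hb' 0
  have hb1 := hb' 1
  have hb2 := hb' 2
  simp only [map_sum, hT, hTb]
  simp only [Fin.sum_univ_three, map_add, map_sub, Derivation.leibniz, smul_eq_mul,
    hd 1 0, hd 2 0, hd 2 1] at *
  linear_combination
    d 0 (b i) * hu0 + d 1 (b i) * hu1 + d 2 (b i) * hu2
      - d 0 (u i) * hb0 - d 1 (u i) * hb1 - d 2 (u i) * hb2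

theorem pd_slice (j : Fin 3) (f : smoothFunctions (ℝ × V3)) (t : ℝ) (x : V3) :
    pd j (fun y => (f : ℝ × V3 → ℝ) (t, y)) x
      = (dirDeriv ((0, Pi.single j 1) : ℝ × V3) f : ℝ × V3 → ℝ) (t, x) := by
  have h := (smoothFunctions_differentiable f (t, x)).hasFDerivAt.comp x
    (hasFDerivAt_prodMk_right t x)
  rw [dirDeriv_apply]
  exact congrArg (fun L : V3 →L[ℝ] ℝ => L (Pi.single j 1)) h.fderiv

theorem deriv_slice (f : smoothFunctions (ℝ × V3)) (t : ℝ) (x : V3) :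
    deriv (fun s => (f : ℝ × V3 → ℝ) (s, x)) t
      = (dirDeriv ((1, 0) : ℝ × V3) f : ℝ × V3 → ℝ) (t, x) := by
  have h := (smoothFunctions_differentiable f (t, x)).hasFDerivAt.comp_hasDerivAt t
    ((hasDerivAt_id t).prodMk (hasDerivAt_const t x))
  exact h.deriv

/-- A component of a smooth vector field, as a smooth function. -/
def smoothComponent (f : ℝ × V3 → V3) (hf : ContDiff ℝ (⊤ : ℕ∞) f) (i : Fin 3) :
    smoothFunctions (ℝ × V3) :=
  ⟨fun p => f p i, contDiff_pi.1 hf i⟩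

/-- unsmoothed form of the ideal LAMHD-α induction equation. -/
theorem lamhd_induction_unsmoothed (α : ℝ) (us Bs : ℝ × V3 → V3)
    (hus : ContDiff ℝ (⊤ : ℕ∞) us) (hBs : ContDiff ℝ (⊤ : ℕ∞) Bs)
    (hdivu : ∀ t : ℝ, ∀ x : V3, divV (tslice us t) x = 0)
    (hdivB : ∀ t : ℝ, ∀ x : V3, divV (tslice Bs t) x = 0)
    (hinduction : ∀ t : ℝ, ∀ x : V3, ∀ i : Fin 3,
      deriv (fun s => Bs (s, x) i) t
        + advect (tslice us t) (tslice Bs t) x i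
        - advect (tslice Bs t) (tslice us t) x i = 0) :
    ∀ t : ℝ, ∀ x : V3, ∀ i : Fin 3,
      deriv (fun s => helm α (tslice Bs s) x i) t
        + advect (tslice us t) (helm α (tslice Bs t)) x i
        - advect (tslice Bs t) (helm α (tslice us t)) x i
      = α ^ 2 * divM (fun y =>
          grad (tslice Bs t) y * grad (tslice us t) y
          + grad (tslice Bs t) y * (grad (tslice us t) y)ᵀ
          - grad (tslice us t) y * grad (tslice Bs t) y
          - grad (tslice us t) y * (grad (tslice Bs t) y)ᵀ) x i := by
  set T := dirDeriv ((1, 0) : ℝ × V3) with hT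
  set d : Fin 3 → Derivation ℝ (smoothFunctions (ℝ × V3)) (smoothFunctions (ℝ × V3)) :=
    fun j => dirDeriv ((0, Pi.single j 1) : ℝ × V3)
  set u := smoothComponent us hus with hu
  set b := smoothComponent Bs hBs with hb
  have hpd : ∀ (j : Fin 3) (f : smoothFunctions (ℝ × V3)) (t : ℝ) (x : V3),
      pd j (fun y => (f : ℝ × V3 → ℝ) (t, y)) x = (d j f : ℝ × V3 → ℝ) (t, x) := pd_slice
  have hpu : ∀ i j t x, pd j (fun y => tslice us t y i) x = (d j (u i) : ℝ × V3 → ℝ) (t, x) :=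
    fun i j t x => hpd j (u i) t x
  have hpb : ∀ i j t x, pd j (fun y => tslice Bs t y i) x = (d j (b i) : ℝ × V3 → ℝ) (t, x) :=
    fun i j t x => hpd j (b i) t x
  have hub : ∀ j t x, (u j : ℝ × V3 → ℝ) (t, x) = us (t, x) j := fun _ _ _ => rfl
  have hbb : ∀ j t x, (b j : ℝ × V3 → ℝ) (t, x) = Bs (t, x) j := fun _ _ _ => rfl
  have hhelm : ∀ (f : ℝ × V3 → V3) (hf : ContDiff ℝ (⊤ : ℕ∞) f) t x i,
      helm α (tslice f t) x i = ((smoothComponent f hf i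
        - α ^ 2 • ∑ k, d k (d k (smoothComponent f hf i)) : smoothFunctions (ℝ × V3)) :
          ℝ × V3 → ℝ) (t, x) := by
    intro f hf t x i
    have hp : ∀ j x, pd j (fun y => tslice f t y i) x
        = (d j (smoothComponent f hf i) : ℝ × V3 → ℝ) (t, x) :=
      fun j x => hpd j (smoothComponent f hf i) t x
    simp [helm, lap, lapS, hp, hpd]
    rfl
  have key := laplacian_induction_eq T d (fun j f => dirDeriv_comm _ _ f)
    (fun j k f => dirDeriv_comm _ _ f) u b
    (by
      ext ⟨t, x⟩
      simpa [divV, hpu] using hdivu t x)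
    (by
      ext ⟨t, x⟩
      simpa [divV, hpb] using hdivB t x)
    (fun i => by
      ext ⟨t, x⟩
      have h := hinduction t x i
      rw [show deriv (fun s => Bs (s, x) i) t = (T (b i) : ℝ × V3 → ℝ) (t, x) from
        deriv_slice (b i) t x] at h
      simp only [advect, hpu, hpb] at h
      simpa [hub, hbb, tslice] using h)
  intro t x i
  have hM : ∀ j, (fun y => (grad (tslice Bs t) y * grad (tslice us t) y
          + grad (tslice Bs t) y * (grad (tslice us t) y)ᵀ
          - grad (tslice us t) y * grad (tslice Bs t) y
          - grad (tslice us t) y * (grad (tslice Bs t) y)ᵀ) i j)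
      = fun y => ((∑ k, d k (b i) * d j (u k) + ∑ k, d k (b i) * d k (u j)
          - ∑ k, d k (u i) * d j (b k) - ∑ k, d k (u i) * d k (b j) :
            smoothFunctions (ℝ × V3)) : ℝ × V3 → ℝ) (t, y) := by
    intro j
    funext y
    simp [Matrix.mul_apply, grad, hpu, hpb]
  have hk := congrArg (fun f : smoothFunctions (ℝ × V3) => (f : ℝ × V3 → ℝ) (t, x)) (key i)
  have hi := hinduction t x i
  rw [show deriv (fun s => Bs (s, x) i) t = (T (b i) : ℝ × V3 → ℝ) (t, x) from
    deriv_slice (b i) t x] at hi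
  simp only [divM, hM, hpd]
  simp only [advect, hhelm us hus, hhelm Bs hBs, deriv_slice, hpd, hpu, hpb] at hi ⊢
  simp only [← hT, ← hu, ← hb, map_sub, Derivation.map_smul] at hi hk ⊢
  generalize (∑ k, d k (d k (b i))) = Lb at *
  generalize (∑ k, d k (d k (u i))) = Lu at *
  simp only [Fin.sum_univ_three, AddSubgroupClass.coe_sub, AddMemClass.coe_add,
    MulMemClass.coe_mul, NegMemClass.coe_neg, SetLike.val_smul,
    Pi.add_apply, Pi.sub_apply, Pi.mul_apply, Pi.neg_apply, Pi.smul_apply, smul_eq_mul,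
    tslice] at hi hk ⊢
  simp only [hub, hbb] at hk
  linear_combination hi - α ^ 2 * hk
end
end
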